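/- Let N ≥ 2 and let λ = (N, N, N−1, N−1, …, 3, 3, 2, 2) be the partition with each of N, N−1, …, 2 occurring exactly twice. For k ≥ 0 let λ1^k be the partition obtained from λ by appending k parts equal to 1. Then for every m ≥ 0 there exists K such that for all k ≥ K the coefficient of x^m in R_{λ1^k}(x) · (1−x)^{N²−1}(1−x²)^{N−1} equals 1 if m = 0 and 0 if m ≥ 1; that is, the limit power series R_{λ1^∞} equals 1/((1−x)^{N²−1}(1−x²)^{N−1}). -/

import Mathlib

open Polynomial

/-- `f` represents the partition `λ₁ ≥ λ₂ ≥ … ≥ λ_N > 0` of `n`: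
`f i = λᵢ` for `1 ≤ i ≤ N` and `f i = 0` for `i > N`. -/
def IsPartitionFun (f : ℕ → ℕ) (n N : ℕ) : Prop :=
  (∀ i j, i ≤ j → f j ≤ f i) ∧ (∀ i, 1 ≤ i → (0 < f i ↔ i ≤ N)) ∧
    ∑ i ∈ Finset.Icc 1 N, f i = n

/-- `A` is strictly upper triangular: `A i j = 0` whenever `j ≤ i`. -/
def StrictUpper {m : ℕ} {F : Type*} [Zero F] (A : Matrix (Fin m) (Fin m) F) : Prop :=
  ∀ i j : Fin m, (j : ℕ) ≤ (i : ℕ) → A i j = 0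

/-- `A` has Jordan type `λ`: `rank (A ^ k) = Σᵢ max (λᵢ - k) 0` for every `k ≥ 0`. -/
def HasJordanType {m : ℕ} {F : Type*} [Field F] (A : Matrix (Fin m) (Fin m) F)
    (f : ℕ → ℕ) (N : ℕ) : Prop :=
  ∀ k : ℕ, (A ^ k).rank = ∑ i ∈ Finset.Icc 1 N, (f i - k)

/-- The number of strictly upper triangular `m × m` matrices over `F` of Jordan type `λ`. -/
noncomputable def jordanCount (m : ℕ) (f : ℕ → ℕ) (N : ℕ)
    (F : Type) [Field F] [Fintype F] : ℕ :=
  Nat.card {A : Matrix (Fin m) (Fin m) F // StrictUpper A ∧ HasJordanType A f N}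

/-- `dualPart f N j = λ'_j`, the number of parts of `λ` that are `≥ j`. -/
def dualPart (f : ℕ → ℕ) (N j : ℕ) : ℕ :=
  ((Finset.Icc 1 N).filter fun i => j ≤ f i).card

/-- `alphaCount f N k = α_k`, the number of parts of `λ` equal to `k`. -/
def alphaCount (f : ℕ → ℕ) (N k : ℕ) : ℕ :=
  ((Finset.Icc 1 N).filter fun i => f i = k).card

/-- The rows containing a removable cell of the Young diagram of `λ`:
rows `1 ≤ i ≤ N` with `i = N` or `λ_{i+1} < λᵢ` (for `i = N` the condition
`f (i+1) < f i` holds automatically since `f (N+1) = 0 < f N`). -/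
def removables (f : ℕ → ℕ) (N : ℕ) : Finset ℕ :=
  (Finset.Icc 1 N).filter fun i => f (i + 1) < f i

/-- The partition `λ1^k` obtained from `λ` (with `N` parts) by appending `k` parts
equal to `1`. -/
def extendOnes (f : ℕ → ℕ) (N k : ℕ) : ℕ → ℕ :=
  fun i => if i ≤ N then f i else if i ≤ N + k then 1 else 0

open Finset

/-- The matrix with upper left block `A`, last column `(v, 0)` and zero last row. -/
def borderMatrix {n : ℕ} {F : Type*} [Zero F] (A : Matrix (Fin n) (Fin n) F) (v : Fin n → F) :
    Matrix (Fin (n + 1)) (Fin (n + 1)) F :=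
  fun i j => Fin.lastCases (motive := fun _ => F) 0
    (fun i' => Fin.lastCases (motive := fun _ => F) (v i') (fun j' => A i' j') j) i

section Border

variable {n : ℕ} {F : Type*}

@[simp] lemma borderMatrix_last [Zero F] (A : Matrix (Fin n) (Fin n) F) (v : Fin n → F)
    (j : Fin (n + 1)) : borderMatrix A v (Fin.last n) j = 0 := by
  simp [borderMatrix]

@[simp] lemma borderMatrix_castSucc_last [Zero F] (A : Matrix (Fin n) (Fin n) F) (v : Fin n → F)
    (i : Fin n) : borderMatrix A v i.castSucc (Fin.last n) = v i := by
  simp [borderMatrix]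

@[simp] lemma borderMatrix_castSucc_castSucc [Zero F] (A : Matrix (Fin n) (Fin n) F)
    (v : Fin n → F) (i j : Fin n) : borderMatrix A v i.castSucc j.castSucc = A i j := by
  simp [borderMatrix]

lemma borderMatrix_mul [Semiring F] (A B : Matrix (Fin n) (Fin n) F) (v w : Fin n → F) :
    borderMatrix A v * borderMatrix B w = borderMatrix (A * B) (A.mulVec w) := by
  ext i j
  rw [Matrix.mul_apply, Fin.sum_univ_castSucc]
  refine Fin.lastCases ?_ (fun i => ?_) i
  · simp
  · refine Fin.lastCases ?_ (fun j => ?_) j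
    · simp [Matrix.mulVec, dotProduct]
    · simp [Matrix.mul_apply]

lemma borderMatrix_pow_succ [Semiring F] (A : Matrix (Fin n) (Fin n) F) (v : Fin n → F) (k : ℕ) :
    borderMatrix A v ^ (k + 1) = borderMatrix (A ^ (k + 1)) ((A ^ k).mulVec v) := by
  induction k with
  | zero => simp
  | succ k ih =>
    rw [pow_succ', ih, borderMatrix_mul, Matrix.mulVec_mulVec, ← pow_succ', ← pow_succ']

/-- Strictly upper triangular matrices of size `n + 1` are the bordered ones. -/
def strictUpperEquiv (n : ℕ) (F : Type*) [Zero F] :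
    {B : Matrix (Fin (n + 1)) (Fin (n + 1)) F // StrictUpper B} ≃
      {A : Matrix (Fin n) (Fin n) F // StrictUpper A} × (Fin n → F) where
  toFun B := (⟨B.1.submatrix Fin.castSucc Fin.castSucc, fun i j h => B.2 _ _ (by simpa using h)⟩,
    fun i => B.1 i.castSucc (Fin.last n))
  invFun p := ⟨borderMatrix p.1.1 p.2, by
    intro i j
    refine Fin.lastCases ?_ (fun i => ?_) i
    · simp
    · refine Fin.lastCases ?_ (fun j => ?_) j
      · intro h
        simp only [Fin.val_last, Fin.val_castSucc] at h
        omega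
      · intro h
        simpa using p.1.2 i j (by simpa using h)⟩
  left_inv B := by
    ext i j
    refine Fin.lastCases ?_ (fun i => ?_) i
    · simpa using (B.2 (Fin.last n) j (Fin.le_last j)).symm
    · refine Fin.lastCases ?_ (fun j => ?_) j <;> simp
  right_inv p := by
    ext <;> simp

/-- Padding a vector by a zero last entry. -/
def padZero (n : ℕ) (F : Type*) [Semiring F] : (Fin n → F) →ₗ[F] (Fin (n + 1) → F) :=
  LinearMap.pi (fun i => Fin.lastCases (motive := fun _ => (Fin n → F) →ₗ[F] F) 0
    (fun i' => LinearMap.proj i') i)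

@[simp] lemma padZero_last [Semiring F] (u : Fin n → F) : padZero n F u (Fin.last n) = 0 := by
  simp [padZero]

@[simp] lemma padZero_castSucc [Semiring F] (u : Fin n → F) (i : Fin n) :
    padZero n F u i.castSucc = u i := by
  simp [padZero]

lemma padZero_injective [Semiring F] : Function.Injective (padZero n F) := by
  intro u v h
  ext i
  simpa using congrFun h i.castSucc

lemma range_borderMatrix [CommRing F] (A : Matrix (Fin n) (Fin n) F) (w : Fin n → F) :
    LinearMap.range (borderMatrix A w).mulVecLin =
      (LinearMap.range A.mulVecLin ⊔ Submodule.span F {w}).map (padZero n F) := by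
  have key : ∀ x : Fin (n + 1) → F, (borderMatrix A w).mulVec x =
      padZero n F (A.mulVec (fun i => x i.castSucc) + x (Fin.last n) • w) := by
    intro x
    ext i
    refine Fin.lastCases ?_ (fun i => ?_) i
    · simp [Matrix.mulVec, dotProduct]
    · simp [Matrix.mulVec, dotProduct, Fin.sum_univ_castSucc, mul_comm]
  ext y
  simp only [LinearMap.mem_range, Submodule.mem_map, Submodule.mem_sup,
    Submodule.mem_span_singleton, Matrix.mulVecLin_apply, key]
  constructor
  · rintro ⟨x, rfl⟩
    exact ⟨_, ⟨_, ⟨_, rfl⟩, _, ⟨_, rfl⟩, rfl⟩, rfl⟩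
  · rintro ⟨_, ⟨_, ⟨u, rfl⟩, _, ⟨c, rfl⟩, rfl⟩, rfl⟩
    exact ⟨Fin.snoc (α := fun _ => F) u c, by simp⟩

open Classical in
lemma rank_borderMatrix [Field F] (A : Matrix (Fin n) (Fin n) F) (w : Fin n → F) :
    (borderMatrix A w).rank = A.rank + if w ∈ LinearMap.range A.mulVecLin then 0 else 1 := by
  rw [Matrix.rank, range_borderMatrix,
    ← (Submodule.equivMapOfInjective _ padZero_injective _).finrank_eq]
  split_ifs with h
  · rw [sup_eq_left.2 (by simpa using h)]
    rfl
  · exact Submodule.finrank_sup_span_singleton h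

end Border

section JordanColumns

variable {n : ℕ} {F : Type*} [Field F]

/-- For nilpotent `A`, the column lengths of the Jordan type of `A`:
`jordanColumns A j` is the number of Jordan blocks of size larger than `j`. -/
noncomputable def jordanColumns (A : Matrix (Fin n) (Fin n) F) (j : ℕ) : ℕ :=
  (A ^ j).rank - (A ^ (j + 1)).rank

lemma rank_pow_succ_le (A : Matrix (Fin n) (Fin n) F) (j : ℕ) :
    (A ^ (j + 1)).rank ≤ (A ^ j).rank := by
  rw [pow_succ]
  exact Matrix.rank_mul_le_left _ _

lemma rank_pow_eq_add (A : Matrix (Fin n) (Fin n) F) (j : ℕ) :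
    (A ^ j).rank = (A ^ (j + 1)).rank + jordanColumns A j := by
  have := rank_pow_succ_le A j
  unfold jordanColumns
  omega

/-- The subspace `im A + ker A ^ j`, as the preimage of `im A ^ (j + 1)` under `A ^ j`. -/
def levelSpace (A : Matrix (Fin n) (Fin n) F) (j : ℕ) : Submodule F (Fin n → F) :=
  (LinearMap.range (A ^ (j + 1)).mulVecLin).comap (A ^ j).mulVecLin

lemma mem_levelSpace {A : Matrix (Fin n) (Fin n) F} {j : ℕ} {v : Fin n → F} :
    v ∈ levelSpace A j ↔ (A ^ j).mulVec v ∈ LinearMap.range (A ^ (j + 1)).mulVecLin := Iff.rfl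

lemma levelSpace_mono (A : Matrix (Fin n) (Fin n) F) : Monotone (levelSpace A) := by
  refine monotone_nat_of_le_succ fun j v => ?_
  rintro ⟨u, hu⟩
  refine ⟨u, ?_⟩
  simp only [Matrix.mulVecLin_apply] at hu ⊢
  rw [pow_succ' A (j + 1), ← Matrix.mulVec_mulVec, hu, Matrix.mulVec_mulVec, ← pow_succ']

lemma finrank_levelSpace_add (A : Matrix (Fin n) (Fin n) F) (j : ℕ) :
    Module.finrank F (levelSpace A j) + jordanColumns A j = n := by
  have h1 := LinearMap.finrank_range_add_finrank_ker
    ((A ^ j).mulVecLin.domRestrict (levelSpace A j))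
  have h2 := LinearMap.finrank_range_add_finrank_ker (A ^ j).mulVecLin
  have h3 := rank_pow_eq_add A j
  have hle : LinearMap.range (A ^ (j + 1)).mulVecLin ≤ LinearMap.range (A ^ j).mulVecLin := by
    rw [pow_succ, Matrix.mulVecLin_mul]
    exact LinearMap.range_comp_le_range _ _
  have hr : LinearMap.range ((A ^ j).mulVecLin.domRestrict (levelSpace A j)) =
      LinearMap.range (A ^ (j + 1)).mulVecLin := by
    rw [LinearMap.range_domRestrict, levelSpace, Submodule.map_comap_eq, inf_eq_right.2 hle]
  have hk : LinearMap.ker (A ^ j).mulVecLin ≤ levelSpace A j :=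
    LinearMap.ker_le_comap _
  have hk2 : Module.finrank F
      (LinearMap.ker ((A ^ j).mulVecLin.domRestrict (levelSpace A j))) =
      Module.finrank F (LinearMap.ker (A ^ j).mulVecLin) := by
    rw [LinearMap.ker_domRestrict]
    exact (Submodule.submoduleOfEquivOfLe hk).finrank_eq
  rw [hr, hk2] at h1
  simp only [Module.finrank_fin_fun] at h2
  unfold Matrix.rank at h3
  omega

lemma jordanColumns_antitone (A : Matrix (Fin n) (Fin n) F) : Antitone (jordanColumns A) := by
  intro i j hij
  have h1 := finrank_levelSpace_add A i
  have h2 := finrank_levelSpace_add A j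
  have h3 := Submodule.finrank_mono (levelSpace_mono A hij)
  omega

lemma StrictUpper.pow_apply {A : Matrix (Fin n) (Fin n) F} (hA : StrictUpper A) (k : ℕ)
    (i j : Fin n) (hij : (j : ℕ) < i + k) : (A ^ k) i j = 0 := by
  induction k generalizing i j with
  | zero =>
    rw [pow_zero, Matrix.one_apply_ne]
    rintro rfl
    simp at hij
  | succ k ih =>
    rw [pow_succ, Matrix.mul_apply]
    refine Finset.sum_eq_zero fun l _ => ?_
    rcases lt_or_ge (l : ℕ) (i + k) with h | h
    · rw [ih i l h, zero_mul]
    · rw [hA l j (by omega), mul_zero]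

lemma StrictUpper.pow_eq_zero {A : Matrix (Fin n) (Fin n) F} (hA : StrictUpper A) {k : ℕ}
    (hk : n ≤ k) : A ^ k = 0 := by
  ext i j
  exact hA.pow_apply k i j (by omega)

/-- The least `j` with `v ∈ im A + ker A ^ j`. -/
noncomputable def level (A : Matrix (Fin n) (Fin n) F) (v : Fin n → F) : ℕ :=
  sInf {j | v ∈ levelSpace A j}

lemma StrictUpper.mem_levelSpace_iff {A : Matrix (Fin n) (Fin n) F} (hA : StrictUpper A)
    (v : Fin n → F) (k : ℕ) : v ∈ levelSpace A k ↔ level A v ≤ k := by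
  have hne : {j | v ∈ levelSpace A j}.Nonempty :=
    ⟨n, by
      rw [Set.mem_ofPred_eq, mem_levelSpace, hA.pow_eq_zero le_rfl, Matrix.zero_mulVec]
      exact zero_mem _⟩
  exact ⟨fun h => Nat.sInf_le h, fun h => levelSpace_mono A h (Nat.sInf_mem hne)⟩

lemma StrictUpper.jordanColumns_borderMatrix {A : Matrix (Fin n) (Fin n) F}
    (hA : StrictUpper A) (v : Fin n → F) (k : ℕ) :
    jordanColumns (borderMatrix A v) k =
      jordanColumns A k + if k = level A v then 1 else 0 := by
  have hrank : ∀ j, (borderMatrix A v ^ (j + 1)).rank =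
      (A ^ (j + 1)).rank + if level A v ≤ j then 0 else 1 := by
    intro j
    rw [borderMatrix_pow_succ, rank_borderMatrix]
    simp only [← mem_levelSpace, hA.mem_levelSpace_iff]
  have h1 := rank_pow_eq_add (borderMatrix A v) k
  have h2 := rank_pow_eq_add A k
  cases k with
  | zero =>
    rw [hrank] at h1
    simp only [pow_zero, Matrix.rank_one, Fintype.card_fin] at h1 h2
    split_ifs at * <;> omega
  | succ k =>
    rw [hrank, hrank] at h1
    split_ifs at * <;> omega

end JordanColumns

section Count

variable (n : ℕ) (F : Type*) [Field F] [Fintype F]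

/-- The number of strictly upper triangular matrices with Jordan columns `b`. -/
noncomputable def columnCount (b : ℕ → ℕ) : ℕ :=
  Nat.card {A : Matrix (Fin n) (Fin n) F // StrictUpper A ∧ jordanColumns A = b}

open Classical in
lemma columnCount_eq_sum (b : ℕ → ℕ) :
    columnCount n F b =
      ∑ A : {A : Matrix (Fin n) (Fin n) F // StrictUpper A},
        if jordanColumns A.1 = b then 1 else 0 := by
  rw [columnCount, Finset.sum_boole, Nat.cast_id, ← Fintype.card_subtype,
    ← Nat.card_eq_fintype_card]
  exact (Nat.card_congr (Equiv.subtypeSubtypeEquivSubtypeInter _ _)).symm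

/-- The number of vectors of level `j` for a matrix of size `n` with Jordan columns `a` over a
field with `q` elements. -/
def levelCount (n : ℕ) (q : ℤ) (a : ℕ → ℕ) : ℕ → ℤ
  | 0 => q ^ (n - a 0)
  | j + 1 => q ^ (n - a (j + 1)) - q ^ (n - a j)

variable {n F}

lemma card_levelSpace (A : Matrix (Fin n) (Fin n) F) (j : ℕ) :
    Nat.card (levelSpace A j) = Fintype.card F ^ (n - jordanColumns A j) := by
  rw [Module.natCard_eq_pow_finrank (K := F), Nat.card_eq_fintype_card]
  congr 1
  have := finrank_levelSpace_add A j
  omega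

open Classical in
lemma StrictUpper.card_level {A : Matrix (Fin n) (Fin n) F} (hA : StrictUpper A) (j : ℕ) :
    ((univ.filter fun v => level A v = j).card : ℤ) =
      levelCount n (Fintype.card F) (jordanColumns A) j := by
  have hcard : ∀ j, (univ.filter fun v => level A v ≤ j).card =
      Fintype.card F ^ (n - jordanColumns A j) := by
    intro j
    rw [← card_levelSpace, ← Fintype.card_subtype, ← Nat.card_eq_fintype_card]
    exact Nat.card_congr (Equiv.subtypeEquivRight fun v => (hA.mem_levelSpace_iff v j).symm)
  cases j with
  | zero =>
    have := hcard 0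
    simp only [Nat.le_zero] at this
    simp [levelCount, this]
  | succ j =>
    have h : (univ.filter fun v => level A v ≤ j + 1).card =
        (univ.filter fun v => level A v ≤ j).card +
          (univ.filter fun v => level A v = j + 1).card := by
      rw [← Finset.card_union_of_disjoint]
      · congr 1
        ext v
        simp
        omega
      · rw [Finset.disjoint_filter]
        intro v _ h1 h2
        omega
    rw [hcard, hcard] at h
    have h' := congrArg (Nat.cast : ℕ → ℤ) h
    push_cast at h'
    simp only [levelCount]
    linarith

/-- Remove a cell from the bottom of column `j`. -/
def dropCell (b : ℕ → ℕ) (j : ℕ) : ℕ → ℕ :=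
  fun i => if i = j then b i - 1 else b i

open Classical in
lemma columnCount_succ (M : ℕ) (b : ℕ → ℕ) (hM : ∀ j, M ≤ j → b j = 0) :
    (columnCount (n + 1) F b : ℤ) =
      ∑ j ∈ range M, if b (j + 1) < b j then
        columnCount n F (dropCell b j) *
          levelCount n (Fintype.card F) (dropCell b j) j else 0 := by
  have hsplit : ∀ (A : {A : Matrix (Fin n) (Fin n) F // StrictUpper A}) (v : Fin n → F),
      (if jordanColumns (borderMatrix A.1 v) = b then (1 : ℤ) else 0) =
        ∑ j ∈ range M, (if b (j + 1) < b j ∧ jordanColumns A.1 = dropCell b j then 1 else 0) *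
          if level A.1 v = j then 1 else 0 := by
    intro A v
    simp only [mul_ite, mul_one, mul_zero]
    rw [Finset.sum_ite_eq]
    have hanti := jordanColumns_antitone A.1 (Nat.le_succ (level A.1 v))
    have hiff : jordanColumns (borderMatrix A.1 v) = b ↔
        level A.1 v ∈ range M ∧ (b (level A.1 v + 1) < b (level A.1 v) ∧
          jordanColumns A.1 = dropCell b (level A.1 v)) := by
      rw [funext_iff, funext_iff]
      simp only [A.2.jordanColumns_borderMatrix, dropCell, Finset.mem_range]
      constructor
      · intro h
        have h0 := h (level A.1 v)
        have h1 := h (level A.1 v + 1)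
        simp at h0 h1
        simp only [Nat.succ_eq_add_one] at hanti
        refine ⟨?_, by omega, fun i => ?_⟩
        · by_contra hcon
          have := hM _ (not_lt.1 hcon)
          omega
        · have := h i
          split_ifs at * <;> omega
      · rintro ⟨-, hlt, h⟩ i
        have := h i
        split_ifs at * with hi
        · subst hi
          omega
        · omega
    by_cases h : jordanColumns (borderMatrix A.1 v) = b
    · rw [if_pos h, if_pos (hiff.1 h).1, if_pos (hiff.1 h).2]
    · rw [if_neg h]
      by_cases h1 : level A.1 v ∈ range M
      · rw [if_pos h1, if_neg fun h2 => h (hiff.2 ⟨h1, h2⟩)]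
      · rw [if_neg h1]
  rw [columnCount_eq_sum, ← (strictUpperEquiv n F).symm.sum_comp, Fintype.sum_prod_type]
  push_cast
  have : ∀ (A : {A : Matrix (Fin n) (Fin n) F // StrictUpper A}) (v : Fin n → F),
      ((strictUpperEquiv n F).symm (A, v)).1 = borderMatrix A.1 v := fun _ _ => rfl
  simp only [this, hsplit]
  rw [Finset.sum_congr rfl fun A _ => Finset.sum_comm, Finset.sum_comm]
  refine Finset.sum_congr rfl fun j _ => ?_
  simp only [← Finset.mul_sum]
  split_ifs with hj
  · rw [columnCount_eq_sum]
    push_cast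
    rw [Finset.sum_mul]
    refine Finset.sum_congr rfl fun A _ => ?_
    rw [Finset.sum_boole, A.2.card_level]
    by_cases h : jordanColumns A.1 = dropCell b j
    · simp [hj, h]
    · simp [h]
  · simp [hj]

end Count

section ReducedCount

/-- `b` lists the column lengths of a partition of `n` with at most `L + 1` columns. -/
structure IsColumns (L n : ℕ) (b : ℕ → ℕ) : Prop where
  antitone : Antitone b
  eq_zero : ∀ j, L < j → b j = 0
  sum_eq : ∑ j ∈ range (L + 1), b j = n

lemma IsColumns.dropCell {L n : ℕ} {b : ℕ → ℕ} (hb : IsColumns L (n + 1) b) {j : ℕ}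
    (hj : b (j + 1) < b j) : IsColumns L n (dropCell b j) where
  antitone := by
    refine antitone_nat_of_succ_le fun i => ?_
    have := hb.antitone (Nat.le_succ i)
    simp only [Nat.succ_eq_add_one] at this
    unfold _root_.dropCell
    split_ifs with h1 h2 h2
    · omega
    · omega
    · subst h2
      omega
    · exact this
  eq_zero i hi := by
    unfold _root_.dropCell
    simp [hb.eq_zero i hi]
  sum_eq := by
    have hjL : j ∈ range (L + 1) := by
      by_contra h
      have := hb.eq_zero j (by simpa using h)
      omega
    have h : ∀ i, b i = _root_.dropCell b j i + if i = j then 1 else 0 := by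
      intro i
      unfold _root_.dropCell
      split_ifs with h1
      · subst h1
        omega
      · rfl
    have h2 := hb.sum_eq
    rw [Finset.sum_congr rfl fun i _ => h i, Finset.sum_add_distrib, Finset.sum_ite_eq',
      if_pos hjL] at h2
    omega

/-- The power of `q` cleared from `columnCount` to obtain `reducedCount`. -/
def columnExponent (L : ℕ) (b : ℕ → ℕ) : ℕ :=
  (b 0).choose 2 + ∑ i ∈ range L, b i * b (i + 1)

lemma columnExponent_dropCell_zero (L : ℕ) (b : ℕ → ℕ) (hL : b (L + 1) = 0) (h : b 1 < b 0) :
    columnExponent L b = columnExponent L (dropCell b 0) + (b 0 - 1) + b 1 := by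
  have hterm : ∀ i, b i * b (i + 1) = dropCell b 0 i * dropCell b 0 (i + 1) +
      if i = 0 then b 1 else 0 := by
    intro i
    unfold dropCell
    rcases i with _ | i
    · obtain ⟨c, hc⟩ := Nat.exists_eq_add_of_lt h
      simp [hc]
      ring
    · simp
  have hchoose : (b 0).choose 2 = (b 0 - 1).choose 2 + (b 0 - 1) := by
    obtain ⟨c, hc⟩ : ∃ c, b 0 = c + 1 := ⟨b 0 - 1, by omega⟩
    rw [hc, Nat.choose_succ_succ' c 1]
    simp
    ring
  have hz : (if 0 ∈ range L then b 1 else 0) = b 1 := by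
    split_ifs with h0
    · rfl
    · obtain rfl : L = 0 := by simpa using h0
      exact hL.symm
  rw [columnExponent, columnExponent, Finset.sum_congr rfl fun i _ => hterm i,
    Finset.sum_add_distrib, Finset.sum_ite_eq', hz, hchoose]
  simp only [dropCell, if_true]
  ring

lemma columnExponent_dropCell_succ (L : ℕ) (b : ℕ → ℕ) (hL : b (L + 1) = 0) (j : ℕ) (hj : j < L)
    (h : b (j + 2) < b (j + 1)) :
    columnExponent L b = columnExponent L (dropCell b (j + 1)) + b j + b (j + 2) := by
  have hterm : ∀ i, b i * b (i + 1) = dropCell b (j + 1) i * dropCell b (j + 1) (i + 1) +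
      (if i = j then b j else 0) + if i = j + 1 then b (j + 2) else 0 := by
    intro i
    obtain ⟨c, hc⟩ := Nat.exists_eq_add_of_lt h
    unfold dropCell
    by_cases h1 : i = j
    · subst h1
      simp [hc]
      ring
    · by_cases h2 : i = j + 1
      · subst h2
        simp [hc]
        ring
      · simp [h1, h2]
  have hz : (if j + 1 ∈ range L then b (j + 2) else 0) = b (j + 2) := by
    split_ifs with h0
    · rfl
    · obtain rfl : L = j + 1 := by
        simp at h0
        omega
      exact hL.symm
  rw [columnExponent, columnExponent, Finset.sum_congr rfl fun i _ => hterm i,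
    Finset.sum_add_distrib, Finset.sum_add_distrib, Finset.sum_ite_eq', Finset.sum_ite_eq', hz,
    if_pos (Finset.mem_range.2 hj)]
  simp only [dropCell, if_neg (Nat.succ_ne_zero j).symm]
  ring

/-- The coefficient with which removing the corner cell of column `j` enters `reducedCount`. -/
noncomputable def cornerWeight (b : ℕ → ℕ) : ℕ → ℤ[X]
  | 0 => X ^ b 1
  | j + 1 => X ^ b (j + 2) * ∑ i ∈ range (b j - b (j + 1) + 1), X ^ i

/-- `columnCount` as a polynomial in the size of the field, without its factors `X` and
`X - 1`. -/
noncomputable def reducedCount (L : ℕ) : ℕ → (ℕ → ℕ) → ℤ[X]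
  | 0, _ => 1
  | n + 1, b => ∑ j ∈ range (L + 1),
      if b (j + 1) < b j then cornerWeight b j * reducedCount L n (dropCell b j) else 0

lemma columnCount_zero {L : ℕ} {F : Type*} [Field F] [Fintype F] {b : ℕ → ℕ}
    (hb : IsColumns L 0 b) : columnCount 0 F b = 1 := by
  classical
  rw [columnCount_eq_sum, Finset.sum_eq_card_nsmul (b := 1)]
  · rw [Finset.card_univ, smul_eq_mul, mul_one]
    refine Fintype.card_eq_one_iff.2 ⟨⟨0, fun i => i.elim0⟩, fun A => Subsingleton.elim _ _⟩
  · intro A _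
    rw [if_pos]
    ext j
    have h1 : ∀ k, (A.1 ^ k).rank = 0 := fun k => Nat.le_zero.1 (by
      simpa using Matrix.rank_le_width (A.1 ^ k))
    rw [jordanColumns, h1, h1]
    rcases le_or_gt j L with h | h
    · exact (Finset.sum_eq_zero_iff.1 hb.sum_eq j (by simpa [Nat.lt_succ_iff] using h)).symm
    · exact (hb.eq_zero j h).symm

lemma levelCount_dropCell {L n : ℕ} {b : ℕ → ℕ} (hb : IsColumns L (n + 1) b) (q : ℤ) {j : ℕ}
    (hjL : j < L + 1) (hj : b (j + 1) < b j) :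
    q ^ columnExponent L b * levelCount n q (dropCell b j) j *
      (q - 1) ^ (∑ i ∈ range L, dropCell b j (i + 1)) =
    q ^ n * q ^ columnExponent L (dropCell b j) * (q - 1) ^ (∑ i ∈ range L, b (i + 1)) *
      (cornerWeight b j).eval q := by
  have hle : ∀ i, dropCell b j i ≤ n := by
    intro i
    have ha := hb.dropCell hj
    rcases le_or_gt i L with h | h
    · rw [← ha.sum_eq]
      exact Finset.single_le_sum (f := dropCell b j) (fun _ _ => Nat.zero_le _)
        (by simpa [Nat.lt_succ_iff] using h)
    · simp [ha.eq_zero i h]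
  have hL := hb.eq_zero (L + 1) (Nat.lt_succ_self L)
  have hs : ∀ i, b i = dropCell b j i + if i = j then 1 else 0 := by
    intro i
    unfold dropCell
    split_ifs with h1
    · subst h1
      omega
    · rfl
  cases j with
  | zero =>
    have hsum : ∑ i ∈ range L, dropCell b 0 (i + 1) = ∑ i ∈ range L, b (i + 1) :=
      Finset.sum_congr rfl fun i _ => by simp [dropCell]
    have h0 : dropCell b 0 0 = b 0 - 1 := by simp [dropCell]
    have hn : n = (b 0 - 1) + (n - dropCell b 0 0) := by
      have := hle 0
      omega
    rw [hsum, columnExponent_dropCell_zero L b hL hj]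
    simp only [levelCount, cornerWeight, eval_pow, eval_X]
    conv_rhs => rw [hn]
    ring
  | succ j =>
    have hsum : ∑ i ∈ range L, b (i + 1) = ∑ i ∈ range L, dropCell b (j + 1) (i + 1) + 1 := by
      rw [Finset.sum_congr rfl fun i _ => hs (i + 1), Finset.sum_add_distrib]
      simp only [Nat.add_right_cancel_iff]
      rw [Finset.sum_ite_eq', if_pos (Finset.mem_range.2 (by omega))]
    have h0 : dropCell b (j + 1) (j + 1) = b (j + 1) - 1 := by simp [dropCell]
    have h1 : dropCell b (j + 1) j = b j := by simp [dropCell]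
    have hanti : b (j + 1) ≤ b j := hb.antitone (Nat.le_succ j)
    have hn : n = b j + (n - b j) := by
      have := hle j
      omega
    have hn2 : n - (b (j + 1) - 1) = (n - b j) + (b j - b (j + 1) + 1) := by
      have := hle j
      omega
    have hgeom := mul_geom_sum q (b j - b (j + 1) + 1)
    rw [hsum, columnExponent_dropCell_succ L b hL j (by omega) hj]
    simp only [levelCount, cornerWeight, eval_pow, eval_X, eval_mul, eval_finsetSum, h0, h1, hn2]
    conv_rhs => rw [hn]
    rw [pow_add q (n - b j), pow_succ (q - 1)]
    linear_combination (-(q ^ (columnExponent L (dropCell b (j + 1)) + b j + b (j + 2)) *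
      q ^ (n - b j) * (q - 1) ^ (∑ i ∈ range L, dropCell b (j + 1) (i + 1)))) * hgeom

lemma columnCount_eq_reducedCount {L n : ℕ} {F : Type*} [Field F] [Fintype F] {b : ℕ → ℕ}
    (hb : IsColumns L n b) :
    (Fintype.card F : ℤ) ^ columnExponent L b * columnCount n F b =
      (Fintype.card F : ℤ) ^ n.choose 2 *
        (Fintype.card F - 1 : ℤ) ^ (∑ i ∈ range L, b (i + 1)) *
        (reducedCount L n b).eval (Fintype.card F : ℤ) := by
  induction n generalizing b with
  | zero =>
    have hz : ∀ j, b j = 0 := by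
      intro j
      rcases le_or_gt j L with h | h
      · exact Finset.sum_eq_zero_iff.1 hb.sum_eq j (by simpa [Nat.lt_succ_iff] using h)
      · exact hb.eq_zero j h
    simp [columnCount_zero hb, columnExponent, reducedCount, hz]
  | succ n ih =>
    rw [columnCount_succ (L + 1) b fun j hj => hb.eq_zero j hj, reducedCount, eval_finsetSum,
      Finset.mul_sum, Finset.mul_sum]
    refine Finset.sum_congr rfl fun j hjL => ?_
    split_ifs with hj
    · have h1 := ih (hb.dropCell hj)
      have h2 := levelCount_dropCell hb (Fintype.card F : ℤ) (Finset.mem_range.1 hjL) hj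
      have hq : (Fintype.card F : ℤ) ≠ 0 := by exact_mod_cast Fintype.card_ne_zero
      have hq1 : (Fintype.card F - 1 : ℤ) ≠ 0 := by
        have := Fintype.one_lt_card (α := F)
        omega
      have hchoose : (n + 1).choose 2 = n + n.choose 2 := by
        rw [Nat.choose_succ_succ' n 1, Nat.choose_one_right]
      set q : ℤ := (Fintype.card F : ℤ)
      apply mul_left_cancel₀ (mul_ne_zero
        (pow_ne_zero (columnExponent L (dropCell b j)) hq)
        (pow_ne_zero (∑ i ∈ range L, dropCell b j (i + 1)) hq1))
      rw [eval_mul, hchoose, pow_add]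
      linear_combination (q ^ columnExponent L (dropCell b j) * columnCount n F (dropCell b j)) * h2
        + (q ^ n * q ^ columnExponent L (dropCell b j) *
          (q - 1) ^ (∑ i ∈ range L, b (i + 1)) * (cornerWeight b j).eval q) * h1
    · simp

lemma reducedCount_eval_one_pos {L n : ℕ} {b : ℕ → ℕ} (hb : IsColumns L n b) :
    0 < (reducedCount L n b).eval 1 := by
  induction n generalizing b with
  | zero => simp [reducedCount]
  | succ n ih =>
    have hw : ∀ j, 0 < (cornerWeight b j).eval 1 := by
      intro j
      cases j with
      | zero => simp [cornerWeight]
      | succ j =>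
        simp [cornerWeight, eval_finsetSum]
    rw [reducedCount, eval_finsetSum]
    have hterm : ∀ j, b (j + 1) < b j → 0 < (if b (j + 1) < b j then
        cornerWeight b j * reducedCount L n (dropCell b j) else 0).eval 1 := by
      intro j hj
      rw [if_pos hj, eval_mul]
      exact mul_pos (hw j) (ih (hb.dropCell hj))
    apply Finset.sum_pos'
    · intro j _
      by_cases hj : b (j + 1) < b j
      · exact (hterm j hj).le
      · simp [hj]
    · by_contra! hcon
      have hconst : ∀ j ∈ range (L + 1), ¬ b (j + 1) < b j := fun j hj hlt =>
        absurd (hterm j hlt) (hcon j hj).not_gt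
      have hzero : ∀ i, i ≤ L + 1 → b (L + 1 - i) = 0 := by
        intro i hi
        induction i with
        | zero => exact hb.eq_zero _ (Nat.lt_succ_self L)
        | succ i ih2 =>
          have h1 := hconst (L + 1 - (i + 1)) (Finset.mem_range.2 (by omega))
          have h2 := ih2 (by omega)
          rw [show L + 1 - (i + 1) + 1 = L + 1 - i by omega] at h1
          omega
      have h3 := hb.sum_eq
      rw [Finset.sum_eq_zero fun j hj => by
        have h4 := hzero (L + 1 - j) (by omega)
        rwa [show L + 1 - (L + 1 - j) = j by
          have := Finset.mem_range.1 hj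
          omega] at h4] at h3
      omega

/-- The denominator of the stable limit of `reducedCount`. -/
noncomputable def stableDenominator (L : ℕ) (b : ℕ → ℕ) : ℤ[X] :=
  ∏ j ∈ range L, ((1 - X) ^ b (j + 1) * ∏ i ∈ range (b (j + 1) - b (j + 2)), (1 - X ^ (i + 1)))

lemma stableDenominator_dropCell_zero (L : ℕ) (b : ℕ → ℕ) :
    stableDenominator L (dropCell b 0) = stableDenominator L b := by
  simp [stableDenominator, dropCell]

lemma stableDenominator_dropCell_one {L : ℕ} (b : ℕ → ℕ) (hL : 0 < L) (h : b 2 < b 1) :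
    stableDenominator L b =
      stableDenominator L (dropCell b 1) * ((1 - X) * (1 - X ^ (b 1 - b 2))) := by
  have hterm : ∀ i, ((1 - X : ℤ[X]) ^ b (i + 1) *
        ∏ k ∈ range (b (i + 1) - b (i + 2)), (1 - X ^ (k + 1))) =
      ((1 - X) ^ dropCell b 1 (i + 1) *
        ∏ k ∈ range (dropCell b 1 (i + 1) - dropCell b 1 (i + 2)), (1 - X ^ (k + 1))) *
        (if i = 0 then (1 - X) * (1 - X ^ (b 1 - b 2)) else 1) := by
    intro i
    unfold dropCell
    rcases i with _ | i
    · obtain ⟨c, hc⟩ := Nat.exists_eq_add_of_lt h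
      have h5 : b 2 + c + 1 - b 2 = c + 1 := by omega
      simp [hc, h5, Finset.prod_range_succ]
      ring
    · simp
  rw [stableDenominator, Finset.prod_congr rfl fun i _ => hterm i, Finset.prod_mul_distrib,
    Finset.prod_ite_eq', if_pos (Finset.mem_range.2 hL), stableDenominator]

lemma stableDenominator_dropCell_add_two {L : ℕ} {b : ℕ → ℕ} (hb : Antitone b) {j : ℕ}
    (hjL : j + 1 < L) (h : b (j + 3) < b (j + 2)) :
    stableDenominator L b * (1 - X ^ (b (j + 1) - b (j + 2) + 1)) =
      stableDenominator L (dropCell b (j + 2)) *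
        ((1 - X) * (1 - X ^ (b (j + 2) - b (j + 3)))) := by
  have hterm : ∀ i, ((1 - X : ℤ[X]) ^ b (i + 1) *
        ∏ k ∈ range (b (i + 1) - b (i + 2)), (1 - X ^ (k + 1))) *
        (if i = j then 1 - X ^ (b (j + 1) - b (j + 2) + 1) else 1) =
      ((1 - X) ^ dropCell b (j + 2) (i + 1) *
        ∏ k ∈ range (dropCell b (j + 2) (i + 1) - dropCell b (j + 2) (i + 2)),
          (1 - X ^ (k + 1))) *
        (if i = j + 1 then (1 - X) * (1 - X ^ (b (j + 2) - b (j + 3))) else 1) := by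
    intro i
    unfold dropCell
    by_cases h1 : i = j + 1
    · subst h1
      obtain ⟨c, hc⟩ := Nat.exists_eq_add_of_lt h
      have h5 : b (j + 3) + c + 1 - b (j + 3) = c + 1 := by omega
      simp [add_assoc, hc, Finset.prod_range_succ]
      ring
    · by_cases h2 : i = j
      · subst h2
        have h3 : b (i + 2) ≤ b (i + 1) := hb (Nat.le_succ (i + 1))
        have h5 : b (i + 1) - (b (i + 2) - 1) = b (i + 1) - b (i + 2) + 1 := by omega
        simp [h5, Finset.prod_range_succ]
        ring
      · simp [h1, h2]
  have h1 : (1 - X ^ (b (j + 1) - b (j + 2) + 1) : ℤ[X]) =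
      ∏ i ∈ range L, if i = j then 1 - X ^ (b (j + 1) - b (j + 2) + 1) else 1 := by
    rw [Finset.prod_ite_eq', if_pos (Finset.mem_range.2 (by omega))]
  have h2 : ((1 - X) * (1 - X ^ (b (j + 2) - b (j + 3))) : ℤ[X]) =
      ∏ i ∈ range L, if i = j + 1 then (1 - X) * (1 - X ^ (b (j + 2) - b (j + 3))) else 1 := by
    rw [Finset.prod_ite_eq', if_pos (Finset.mem_range.2 hjL)]
  rw [h1, h2, stableDenominator, stableDenominator, ← Finset.prod_mul_distrib,
    ← Finset.prod_mul_distrib]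
  exact Finset.prod_congr rfl fun i _ => hterm i

lemma one_sub_X_pow_dvd_one_sub_mul {R : Type*} [CommRing R] {x y z : R} (hy : x ∣ y)
    (hz : x ∣ z - 1) : x ∣ (1 - y) * z - 1 := by
  have : (1 - y) * z - 1 = (z - 1) - y * z := by ring
  rw [this]
  exact dvd_sub hz (hy.mul_right z)

lemma stableDenominator_mul_cornerWeight_one {L : ℕ} (b : ℕ → ℕ) (hL : 0 < L) (h : b 2 < b 1) :
    stableDenominator L b * cornerWeight b 1 =
      (X ^ b 2 - X ^ b 1) * (1 - X ^ (b 0 - b 1 + 1)) * stableDenominator L (dropCell b 1) := by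
  have hg := mul_neg_geom_sum (X : ℤ[X]) (b 0 - b 1 + 1)
  have hp : (X : ℤ[X]) ^ b 1 = X ^ b 2 * X ^ (b 1 - b 2) := by
    rw [← pow_add, Nat.add_sub_cancel' h.le]
  rw [stableDenominator_dropCell_one b hL h, cornerWeight, ← hg, hp]
  ring

lemma stableDenominator_mul_cornerWeight_add_two {L : ℕ} {b : ℕ → ℕ} (hb : Antitone b) {j : ℕ}
    (hjL : j + 1 < L) (h : b (j + 3) < b (j + 2)) :
    stableDenominator L b * cornerWeight b (j + 2) =
      (X ^ b (j + 3) - X ^ b (j + 2)) * stableDenominator L (dropCell b (j + 2)) := by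
  have hg := mul_neg_geom_sum (X : ℤ[X]) (b (j + 1) - b (j + 2) + 1)
  have hp : (X : ℤ[X]) ^ b (j + 2) = X ^ b (j + 3) * X ^ (b (j + 2) - b (j + 3)) := by
    rw [← pow_add, Nat.add_sub_cancel' h.le]
  have hs := stableDenominator_dropCell_add_two hb hjL h
  have hX : (1 - X : ℤ[X]) ≠ 0 := by
    intro h0
    simpa using congrArg (eval 0) h0
  apply mul_left_cancel₀ hX
  rw [cornerWeight, hp]
  linear_combination X ^ b (j + 3) * hs + stableDenominator L b * X ^ b (j + 3) * hg

lemma reducedCount_of_one_column {L n : ℕ} {b : ℕ → ℕ} (hb : IsColumns L n b) (h : b 1 = 0) :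
    reducedCount L n b = 1 := by
  induction n generalizing b with
  | zero => rfl
  | succ n ih =>
    have hz : ∀ j, b (j + 1) = 0 := fun j =>
      Nat.le_zero.1 (h ▸ hb.antitone (Nat.succ_le_succ (Nat.zero_le j)))
    have hs := hb.sum_eq
    rw [Finset.sum_range_succ', Finset.sum_eq_zero fun j _ => hz j, zero_add] at hs
    have hlt : b (0 + 1) < b 0 := by
      rw [zero_add]
      omega
    rw [reducedCount, Finset.sum_range_succ', Finset.sum_eq_zero, zero_add,
      if_pos hlt, ih (hb.dropCell hlt) (by simp [dropCell, h])]
    · simp [cornerWeight, h]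
    · intro j _
      rw [if_neg (by simp [hz])]

lemma stableDenominator_mul_reducedCount_of_one_column {L n : ℕ} {b : ℕ → ℕ}
    (hb : IsColumns L n b) (h : b 1 = 0) : stableDenominator L b * reducedCount L n b = 1 := by
  have hz : ∀ j, b (j + 1) = 0 := fun j =>
    Nat.le_zero.1 (h ▸ hb.antitone (Nat.succ_le_succ (Nat.zero_le j)))
  rw [reducedCount_of_one_column hb h]
  simp [stableDenominator, hz]

/-- `reducedCount` agrees with `1 / stableDenominator` up to order `b 0 - b 1`. -/
lemma stableDenominator_mul_reducedCount {L n : ℕ} {b : ℕ → ℕ} (hb : IsColumns L n b) :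
    X ^ (b 0 - b 1 + 1) ∣ stableDenominator L b * reducedCount L n b - 1 := by
  by_cases hb1 : b 1 = 0
  · simp [stableDenominator_mul_reducedCount_of_one_column hb hb1]
  induction n generalizing b with
  | zero =>
    refine absurd ?_ hb1
    rcases le_or_gt 1 L with h | h
    · exact Finset.sum_eq_zero_iff.1 hb.sum_eq 1 (Finset.mem_range.2 (by omega))
    · exact hb.eq_zero 1 h
  | succ n ih0 =>
    have ih : ∀ a, IsColumns L n a →
        X ^ (a 0 - a 1 + 1) ∣ stableDenominator L a * reducedCount L n a - 1 := by
      intro a ha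
      by_cases ha1 : a 1 = 0
      · simp [stableDenominator_mul_reducedCount_of_one_column ha ha1]
      · exact ih0 ha ha1
    have hanti : ∀ j, b (j + 1) ≤ b j := fun j => hb.antitone (Nat.le_succ j)
    have hone : (1 : ℤ[X]) = ∑ j ∈ range (L + 1),
        (X ^ b (j + 1) - if j = 0 then 0 else X ^ b j) := by
      rw [Finset.sum_range_succ']
      simp only [Nat.succ_ne_zero, if_false, if_true]
      rw [Finset.sum_range_sub fun j => (X : ℤ[X]) ^ b (j + 1),
        hb.eq_zero (L + 1) (Nat.lt_succ_self L)]
      simp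
    rw [hone]
    rw [reducedCount, Finset.mul_sum, ← Finset.sum_sub_distrib]
    refine Finset.dvd_sum fun j hjL => ?_
    rw [Finset.mem_range] at hjL
    rw [mul_ite, mul_zero]
    have hexp : ∀ j, b (j + 1) < b j → 0 < j →
        X ^ (b 0 - b 1 + 1) ∣ stableDenominator L (dropCell b j) *
          reducedCount L n (dropCell b j) - 1 := by
      intro j hj h0
      refine (pow_dvd_pow X ?_).trans (ih _ (hb.dropCell hj))
      unfold dropCell
      split_ifs <;> omega
    rcases j with _ | _ | j
    · simp only [zero_add, if_true, sub_zero]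
      split_ifs with h
      · have hd := ih _ (hb.dropCell h)
        rw [stableDenominator_dropCell_zero] at hd
        have hfac : stableDenominator L b * (cornerWeight b 0 *
            reducedCount L n (dropCell b 0)) - X ^ b 1 = X ^ b 1 *
            (stableDenominator L b * reducedCount L n (dropCell b 0) - 1) := by
          rw [cornerWeight]
          ring
        rw [hfac]
        refine (pow_dvd_pow X ?_).trans ((pow_add X _ _).dvd.trans (mul_dvd_mul_left _ hd))
        simp [dropCell]
        omega
      · rw [zero_sub, dvd_neg]
        exact pow_dvd_pow X (by omega)
    · simp only [zero_add, Nat.reduceAdd, one_ne_zero, if_false]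
      split_ifs with h
      · rw [← mul_assoc, stableDenominator_mul_cornerWeight_one b (by omega) h]
        have hd := one_sub_X_pow_dvd_one_sub_mul dvd_rfl (hexp 1 h one_pos)
        refine (hd.mul_left (X ^ b 2 - X ^ b 1)).trans (dvd_of_eq ?_)
        ring
      · rw [show b 2 = b 1 from le_antisymm (hanti 1) (not_lt.1 h)]
        simp
    · simp only [Nat.succ_ne_zero, if_false, add_assoc, Nat.reduceAdd]
      split_ifs with h
      · rw [← mul_assoc, stableDenominator_mul_cornerWeight_add_two hb.antitone (by omega) h]
        refine ((hexp (j + 2) h (by omega)).mul_left (X ^ b (j + 3) - X ^ b (j + 2))).trans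
          (dvd_of_eq ?_)
        ring
      · rw [show b (j + 3) = b (j + 2) from le_antisymm (hanti _) (not_lt.1 h)]
        simp

end ReducedCount

section Factorization

lemma X_sub_C_pow_mul_cancel {R : Type*} [CommRing R] [IsDomain R] {t : R} {p q : R[X]}
    {a c : ℕ} (hp : p.eval t ≠ 0) (hq : q.eval t ≠ 0)
    (h : (X - C t) ^ a * p = (X - C t) ^ c * q) : p = q := by
  wlog hac : a ≤ c generalizing a c p q
  · exact (this hq hp h.symm (le_of_not_ge hac)).symm
  obtain ⟨m, rfl⟩ := Nat.exists_eq_add_of_le hac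
  rw [pow_add, mul_assoc] at h
  have h' := mul_left_cancel₀ (pow_ne_zero a (X_sub_C_ne_zero t)) h
  cases m with
  | zero => simpa using h'
  | succ m =>
    rw [h'] at hp
    simp at hp

lemma X_pow_mul_X_sub_one_pow_mul_cancel {p q : ℤ[X]} {a c a' c' : ℕ} (hp0 : p.eval 0 ≠ 0)
    (hp1 : p.eval 1 ≠ 0) (hq0 : q.eval 0 ≠ 0) (hq1 : q.eval 1 ≠ 0)
    (h : X ^ a * (X - 1) ^ a' * p = X ^ c * (X - 1) ^ c' * q) : p = q := by
  have h' : (X - C 0) ^ a * ((X - C 1) ^ a' * p) = (X - C 0) ^ c * ((X - C 1) ^ c' * q) := by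
    simpa [mul_assoc] using h
  refine X_sub_C_pow_mul_cancel hp1 hq1 (X_sub_C_pow_mul_cancel (t := (0 : ℤ)) ?_ ?_ h')
  · simp [hp0]
  · simp [hq0]

end Factorization

section Partition

lemma sum_tsub_eq_add_dualPart (f : ℕ → ℕ) (N k : ℕ) :
    ∑ i ∈ Icc 1 N, (f i - k) = ∑ i ∈ Icc 1 N, (f i - (k + 1)) + dualPart f N (k + 1) := by
  rw [dualPart, Finset.card_filter, ← Finset.sum_add_distrib]
  refine Finset.sum_congr rfl fun i _ => ?_
  split_ifs <;> omega

lemma hasJordanType_iff {n : ℕ} {F : Type*} [Field F] (A : Matrix (Fin n) (Fin n) F)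
    (f : ℕ → ℕ) (N : ℕ) (hn : ∑ i ∈ Icc 1 N, f i = n) :
    HasJordanType A f N ↔ jordanColumns A = fun k => dualPart f N (k + 1) := by
  constructor
  · intro h
    ext k
    have h1 := rank_pow_eq_add A k
    rw [h k, h (k + 1), sum_tsub_eq_add_dualPart] at h1
    omega
  · intro h k
    induction k with
    | zero => simp [hn]
    | succ k ih =>
      have h1 := rank_pow_eq_add A k
      have h2 := sum_tsub_eq_add_dualPart f N k
      rw [h] at h1
      simp only at h1
      omega

lemma jordanCount_eq_columnCount (n : ℕ) (F : Type) [Field F] [Fintype F] (f : ℕ → ℕ) (N : ℕ)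
    (hn : ∑ i ∈ Icc 1 N, f i = n) :
    jordanCount n f N F = columnCount n F fun k => dualPart f N (k + 1) := by
  simp only [jordanCount, columnCount, hasJordanType_iff _ f N hn]

lemma sum_Icc_extendOnes (f : ℕ → ℕ) (N k : ℕ) :
    ∑ i ∈ Icc 1 (N + k), extendOnes f N k i = ∑ i ∈ Icc 1 N, f i + k := by
  induction k with
  | zero =>
    refine Finset.sum_congr rfl fun i hi => ?_
    exact if_pos (Finset.mem_Icc.1 hi).2
  | succ k ih =>
    rw [← add_assoc, Finset.sum_Icc_succ_top (by omega), ← add_assoc, ← ih]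
    congr 1
    · refine Finset.sum_congr rfl fun i hi => ?_
      have := (Finset.mem_Icc.1 hi).2
      unfold extendOnes
      split_ifs <;> first | rfl | omega
    · unfold extendOnes
      split_ifs <;> first | rfl | omega

/-- The column lengths of `(N, N, …, 2, 2)` with `k` parts `1` appended. -/
def staircaseColumns (N k : ℕ) : ℕ → ℕ
  | 0 => 2 * (N - 1) + k
  | j + 1 => 2 * (N - (j + 1))

lemma dualPart_staircase (N : ℕ) (f : ℕ → ℕ)
    (hval : ∀ i, 1 ≤ i → i ≤ 2 * (N - 1) → f i = N - (i - 1) / 2) (k j : ℕ) :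
    dualPart (extendOnes f (2 * (N - 1)) k) (2 * (N - 1) + k) (j + 1) =
      staircaseColumns N k j := by
  have hle : ∀ i, 1 ≤ i → i ≤ 2 * (N - 1) + k →
      (j + 1 ≤ extendOnes f (2 * (N - 1)) k i ↔ i ≤ staircaseColumns N k j) := by
    intro i h1 h2
    unfold extendOnes
    split_ifs with h3
    · rw [hval i h1 h3]
      cases j <;> simp only [staircaseColumns] <;> omega
    · cases j <;> simp only [staircaseColumns] <;> omega
  have hsub : staircaseColumns N k j ≤ 2 * (N - 1) + k := by
    cases j <;> simp only [staircaseColumns] <;> omega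
  rw [dualPart, Finset.filter_congr fun i hi =>
    hle i (Finset.mem_Icc.1 hi).1 (Finset.mem_Icc.1 hi).2]
  have : (Icc 1 (2 * (N - 1) + k)).filter (fun i => i ≤ staircaseColumns N k j) =
      Icc 1 (staircaseColumns N k j) := by
    ext i
    simp only [Finset.mem_filter, Finset.mem_Icc]
    omega
  simp [this]

lemma sum_range_two_mul_sub (L : ℕ) : ∑ j ∈ range L, 2 * (L - j) = L * (L + 1) := by
  rw [← Finset.mul_sum, ← Finset.sum_range_reflect]
  have : ∀ j ∈ range L, L - (L - 1 - j) = j + 1 := by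
    intro j hj
    have := Finset.mem_range.1 hj
    omega
  rw [Finset.sum_congr rfl this, Finset.sum_add_distrib]
  have := Finset.sum_range_id_mul_two L
  have h2 : L * (L - 1) + L = L * L := by
    cases L <;> simp [Nat.mul_succ]
  simp only [Finset.sum_const, Finset.card_range, smul_eq_mul, mul_one]
  nlinarith

lemma isColumns_staircaseColumns (L k : ℕ) :
    IsColumns L (L * L + 3 * L + k) (staircaseColumns (L + 1) k) where
  antitone := by
    refine antitone_nat_of_succ_le fun j => ?_
    cases j <;> simp only [staircaseColumns] <;> omega
  eq_zero j hj := by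
    cases j with
    | zero => omega
    | succ j =>
      simp only [staircaseColumns]
      omega
  sum_eq := by
    rw [Finset.sum_range_succ']
    simp only [staircaseColumns, Nat.add_sub_add_right, Nat.add_sub_cancel,
      sum_range_two_mul_sub]
    ring

lemma stableDenominator_staircaseColumns (L k : ℕ) :
    stableDenominator L (staircaseColumns (L + 1) k) =
      (1 - X) ^ ((L + 1) * (L + 1) - 1) * (1 - X ^ 2) ^ L := by
  have hprod : ∀ j ∈ range L, ∏ i ∈ range (2 * (L + 1 - (j + 1)) - 2 * (L + 1 - (j + 1 + 1))),
      (1 - X ^ (i + 1) : ℤ[X]) = (1 - X) * (1 - X ^ 2) := by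
    intro j hj
    have := Finset.mem_range.1 hj
    rw [show 2 * (L + 1 - (j + 1)) - 2 * (L + 1 - (j + 1 + 1)) = 2 by omega]
    simp [Finset.prod_range_succ]
  have hexp : (L + 1) * (L + 1) - 1 = L * (L + 1) + L := by
    have : (L + 1) * (L + 1) = L * (L + 1) + L + 1 := by ring
    omega
  simp only [stableDenominator, staircaseColumns]
  rw [Finset.prod_mul_distrib, Finset.prod_congr rfl hprod, Finset.prod_const,
    Finset.prod_pow_eq_pow_sum]
  simp only [Nat.add_sub_add_right, sum_range_two_mul_sub, Finset.card_range]
  rw [hexp, pow_add, mul_pow]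
  ring

end Partition

theorem R_limit_doubled_staircase (N : ℕ) (hN : 2 ≤ N) (f : ℕ → ℕ)
    (hf : IsPartitionFun f (N * N + N - 2) (2 * (N - 1)))
    (hval : ∀ i, 1 ≤ i → i ≤ 2 * (N - 1) → f i = N - (i - 1) / 2)
    (P R : ℕ → Polynomial ℤ) (d e : ℕ → ℕ)
    (hP : ∀ k : ℕ, ∀ (F : Type) [Field F] [Fintype F],
      (jordanCount ((N * N + N - 2) + k) (extendOnes f (2 * (N - 1)) k) (2 * (N - 1) + k) F : ℤ) =
        (P k).eval (Fintype.card F : ℤ))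
    (hfac : ∀ k : ℕ, P k = X ^ (d k) * (X - 1) ^ (e k) * R k)
    (hR0 : ∀ k : ℕ, (R k).eval 0 ≠ 0) (hR1 : ∀ k : ℕ, (R k).eval 1 ≠ 0) :
    ∀ m : ℕ, ∃ K : ℕ, ∀ k : ℕ, K ≤ k →
      (R k * ((1 - X : Polynomial ℤ) ^ (N * N - 1) *
        (1 - (X : Polynomial ℤ) ^ 2) ^ (N - 1))).coeff m =
      if m = 0 then 1 else 0 := by
  obtain ⟨L, rfl⟩ : ∃ L, N = L + 1 := ⟨N - 1, by omega⟩
  have hsize : (L + 1) * (L + 1) + (L + 1) - 2 = L * L + 3 * L := by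
    have : (L + 1) * (L + 1) + (L + 1) = L * L + 3 * L + 2 := by ring
    omega
  rw [hsize] at hf
  rw [hsize] at hP
  rw [Nat.add_sub_cancel]
  intro m
  refine ⟨m, fun k hk => ?_⟩
  set b := staircaseColumns (L + 1) k with hb_def
  have hb : IsColumns L (L * L + 3 * L + k) b := isColumns_staircaseColumns L k
  set Z := reducedCount L (L * L + 3 * L + k) b with hZ_def
  have hdvd := stableDenominator_mul_reducedCount hb
  rw [stableDenominator_staircaseColumns L k, ← hZ_def] at hdvd
  have hb01 : b 0 - b 1 + 1 = k + 1 := by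
    simp only [hb_def, staircaseColumns]
    omega
  rw [hb01] at hdvd
  have hcoeff := X_pow_dvd_iff.1 hdvd
  have hpoly : X ^ columnExponent L b * P k =
      X ^ (L * L + 3 * L + k).choose 2 * (X - 1) ^ (∑ i ∈ range L, b (i + 1)) * Z := by
    refine Polynomial.eq_of_infinite_eval_eq _ _ (Set.Infinite.mono ?_
      (Nat.infinite_setOfPred_prime.image (Nat.cast_injective (R := ℤ)).injOn))
    rintro _ ⟨p, hp, rfl⟩
    have : Fact p.Prime := ⟨hp⟩
    have h1 := columnCount_eq_reducedCount (F := ZMod p) hb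
    have h2 := hP k (ZMod p)
    rw [jordanCount_eq_columnCount _ _ _ _ (by rw [sum_Icc_extendOnes, hf.2.2])] at h2
    simp only [dualPart_staircase (L + 1) f hval k] at h2
    rw [h2, ZMod.card] at h1
    simpa using h1
  have hZ0 : Z.eval 0 ≠ 0 := by
    intro h0
    have := hcoeff 0 (Nat.succ_pos k)
    rw [coeff_zero_eq_eval_zero] at this
    simp [h0] at this
  have hRZ : R k = Z := by
    refine X_pow_mul_X_sub_one_pow_mul_cancel (a := columnExponent L b + d k) (a' := e k) (hR0 k) (hR1 k) hZ0
      (reducedCount_eval_one_pos hb).ne' (Eq.trans ?_ hpoly)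
    rw [hfac k]
    ring
  have := hcoeff m (by omega)
  rw [coeff_sub, sub_eq_zero, coeff_one] at this
  rw [hRZ, mul_comm, this]
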